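/- Let Λ be a ring and R = (Λ 0; Λ Λ) the triangular matrix ring with M = Λ the regular (Λ,Λ)-bimodule. For a right Λ-module X, the right R-module (X, 0) ⊕ (X, X)_{id} is a silting (respectively, tilting) R-module if and only if X is a silting (respectively, tilting) right Λ-module. -/

import Mathlib

set_option linter.unusedSectionVars false

/-!
Framework for right modules over the triangular matrix ring `R = (Λ 0; Λ Λ)`.
Right `S`-modules are encoded as modules over the opposite ring `Sᵐᵒᵖ`.  Using the
identification `Y ⊗_Λ Λ ≅ Y`, a right `R`-module is encoded as a triple `(X, Y)_f`
where `X`, `Y` are right `Λ`-modules and `f : Y → X` is `Λ`-linear (`TPair`), with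
morphisms `(α, β)` satisfying `α ∘ f = f' ∘ β`.
-/

open Function

universe u

section LightTriangular

variable (Λ : Type u) [Ring Λ]

/-- A triple `(X, Y)_f` with `f : Y → X` a homomorphism of right `Λ`-modules:
an object of the category of right modules over `R = (Λ 0; Λ Λ)`. -/
structure TPair : Type (u + 1) where
  car₁ : Type u
  car₂ : Type u
  [ag₁ : AddCommGroup car₁]
  [mod₁ : Module Λᵐᵒᵖ car₁]
  [ag₂ : AddCommGroup car₂]
  [mod₂ : Module Λᵐᵒᵖ car₂]
  str : car₂ →ₗ[Λᵐᵒᵖ] car₁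

attribute [instance] TPair.ag₁ TPair.mod₁ TPair.ag₂ TPair.mod₂

/-- A homomorphism of triples (right `R`-modules): a pair `(α, β)` with
`α ∘ f = f' ∘ β`. -/
structure TPairHom (A B : TPair Λ) : Type u where
  h₁ : A.car₁ →ₗ[Λᵐᵒᵖ] B.car₁
  h₂ : A.car₂ →ₗ[Λᵐᵒᵖ] B.car₂
  comm : ∀ y, h₁ (A.str y) = B.str (h₂ y)

variable {Λ}

/-- Composition of homomorphisms of triples. -/
def TPairHom.comp {A B C : TPair Λ} (g : TPairHom Λ B C) (f : TPairHom Λ A B) :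
    TPairHom Λ A C where
  h₁ := g.h₁.comp f.h₁
  h₂ := g.h₂.comp f.h₂
  comm y := by simp only [LinearMap.comp_apply, f.comm, g.comm]

/-- The identity homomorphism of a triple. -/
def TPairHom.id (A : TPair Λ) : TPairHom Λ A A :=
  ⟨LinearMap.id, LinearMap.id, fun _ => rfl⟩

/-- `D_σ` for a homomorphism `σ : P₁ → P₀` of (right) `S`-modules: the class of modules
`A` such that `Hom_S(σ, A)` is surjective. -/
def DMod {S : Type u} [Ring S] {P₁ P₀ : Type u} [AddCommGroup P₁] [Module S P₁]
    [AddCommGroup P₀] [Module S P₀] (σ : P₁ →ₗ[S] P₀)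
    (A : Type u) [AddCommGroup A] [Module S A] : Prop :=
  ∀ g : P₁ →ₗ[S] A, ∃ g' : P₀ →ₗ[S] A, g'.comp σ = g

/-- `D_σ` for a homomorphism of triples (right `R`-modules). -/
def DTPair {P₁ P₀ : TPair Λ} (σ : TPairHom Λ P₁ P₀) (A : TPair Λ) : Prop :=
  ∀ φ : TPairHom Λ P₁ A, ∃ ψ : TPairHom Λ P₀ A, ψ.comp σ = φ

/-- `A ∈ Gen T` for right `S`-modules: `A` is an epimorphic image of a direct sum of
copies of `T`. -/
def GenMod (S : Type u) [Ring S] (T : Type u) [AddCommGroup T] [Module S T]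
    (A : Type u) [AddCommGroup A] [Module S A] : Prop :=
  ∃ (ι : Type u) (φ : (ι →₀ T) →ₗ[S] A), Surjective φ

/-- The direct sum of `ι` copies of a triple. -/
noncomputable def copiesTPair (T : TPair Λ) (ι : Type u) : TPair Λ :=
  ⟨ι →₀ T.car₁, ι →₀ T.car₂, Finsupp.mapRange.linearMap T.str⟩

/-- `A ∈ Gen T` for triples (right `R`-modules). -/
def GenTPair (T A : TPair Λ) : Prop :=
  ∃ (ι : Type u) (φ : TPairHom Λ (copiesTPair T ι) A), Surjective φ.h₁ ∧ Surjective φ.h₂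

/-- Projectivity of a triple (categorical projectivity in the category of right
`R`-modules; epimorphisms are componentwise surjections). -/
def TPairProjective (P : TPair Λ) : Prop :=
  ∀ (B C : TPair Λ) (g : TPairHom Λ B C), Surjective g.h₁ → Surjective g.h₂ →
    ∀ φ : TPairHom Λ P C, ∃ ψ : TPairHom Λ P B, g.comp ψ = φ

/-- A silting right `S`-module: `T` admits a projective presentation
`P₁ →σ P₀ →π T → 0` with `Gen T = D_σ`. -/
def IsSiltingMod (S : Type u) [Ring S] (T : Type u) [AddCommGroup T] [Module S T] : Prop :=
  ∃ (P₁ P₀ : ModuleCat.{u} S) (σ : ↥P₁ →ₗ[S] ↥P₀) (π : ↥P₀ →ₗ[S] T),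
    Module.Projective S P₁ ∧ Module.Projective S P₀ ∧
    Surjective π ∧ Function.Exact σ π ∧
    ∀ (A : Type u) [AddCommGroup A] [Module S A], (GenMod S T A ↔ DMod σ A)

/-- A silting triple (right `R`-module). -/
def IsSiltingTPair (T : TPair Λ) : Prop :=
  ∃ (P₁ P₀ : TPair Λ) (σ : TPairHom Λ P₁ P₀) (π : TPairHom Λ P₀ T),
    TPairProjective P₁ ∧ TPairProjective P₀ ∧
    Surjective π.h₁ ∧ Surjective π.h₂ ∧
    Function.Exact σ.h₁ π.h₁ ∧ Function.Exact σ.h₂ π.h₂ ∧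
    ∀ A : TPair Λ, (GenTPair T A ↔ DTPair σ A)

/-- `Ext¹_S(T, N) = 0`, expressed by the splitting of all short exact sequences
`0 → N → E → T → 0`. -/
def Ext1VanishMod (S : Type u) [Ring S] (T N : Type u) [AddCommGroup T] [Module S T]
    [AddCommGroup N] [Module S N] : Prop :=
  ∀ (E : Type u) [AddCommGroup E] [Module S E] (i : N →ₗ[S] E) (p : E →ₗ[S] T),
    Injective i → Surjective p → Function.Exact i p →
    ∃ s : T →ₗ[S] E, p.comp s = LinearMap.id

/-- A tilting right `S`-module: `Gen T = {N ∣ Ext¹_S(T, N) = 0}`. -/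
def IsTiltingMod (S : Type u) [Ring S] (T : Type u) [AddCommGroup T] [Module S T] : Prop :=
  ∀ (N : Type u) [AddCommGroup N] [Module S N], GenMod S T N ↔ Ext1VanishMod S T N

/-- `Ext¹_R(T, N) = 0` for triples, expressed by the splitting of all short exact
sequences `0 → N → E → T → 0` of triples (monomorphisms, epimorphisms and exactness
are componentwise). -/
def Ext1VanishTPair (T N : TPair Λ) : Prop :=
  ∀ (E : TPair Λ) (i : TPairHom Λ N E) (p : TPairHom Λ E T),
    Injective i.h₁ → Injective i.h₂ → Surjective p.h₁ → Surjective p.h₂ →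
    Function.Exact i.h₁ p.h₁ → Function.Exact i.h₂ p.h₂ →
    ∃ s : TPairHom Λ T E, p.comp s = TPairHom.id T

/-- A tilting triple (right `R`-module): `Gen T = {N ∣ Ext¹_R(T, N) = 0}`. -/
def IsTiltingTPair (T : TPair Λ) : Prop :=
  ∀ N : TPair Λ, GenTPair T N ↔ Ext1VanishTPair T N

variable (Λ)

/-- The triple `(X, 0) ⊕ (Y, Y)_{id}`: first component `X ⊕ Y`, second component `Y`,
structure map `y ↦ (0, y)`. -/
def sumPair (X Y : Type u) [AddCommGroup X] [Module Λᵐᵒᵖ X]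
    [AddCommGroup Y] [Module Λᵐᵒᵖ Y] : TPair Λ :=
  ⟨X × Y, Y, LinearMap.prod (0 : Y →ₗ[Λᵐᵒᵖ] X) LinearMap.id⟩

end LightTriangular

section TriangularLemmas

variable {Λ : Type u} [Ring Λ]

theorem TPairHom.ext' {A B : TPair Λ} {f g : TPairHom Λ A B} (h₁ : f.h₁ = g.h₁)
    (h₂ : f.h₂ = g.h₂) : f = g := by
  cases f; cases g; cases h₁; cases h₂; rfl

section SumPair

variable {P Q : Type u} [AddCommGroup P] [Module Λᵐᵒᵖ P] [AddCommGroup Q] [Module Λᵐᵒᵖ Q]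

/-- The morphism `(P, 0) ⊕ (P, P)_{id} → A` given by maps `P → A.car₁` and `P → A.car₂`. -/
def sumPairDesc {A : TPair Λ} (a : P →ₗ[Λᵐᵒᵖ] A.car₁) (b : P →ₗ[Λᵐᵒᵖ] A.car₂) :
    TPairHom Λ (sumPair Λ P P) A where
  h₁ := (a.coprod (A.str.comp b) : P × P →ₗ[Λᵐᵒᵖ] A.car₁)
  h₂ := b
  comm y := by
    change a 0 + A.str (b y) = A.str (b y)
    simp

/-- The restriction of a morphism out of `(P, 0) ⊕ (P, P)_{id}` to `(P, 0)`. -/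
def sumPairFst {A : TPair Λ} (φ : TPairHom Λ (sumPair Λ P P) A) : P →ₗ[Λᵐᵒᵖ] A.car₁ :=
  LinearMap.comp (M₂ := P × P) φ.h₁ (LinearMap.inl Λᵐᵒᵖ P P)

/-- The restriction of a morphism out of `(P, 0) ⊕ (P, P)_{id}` to `(P, P)_{id}`. -/
def sumPairSnd {A : TPair Λ} (φ : TPairHom Λ (sumPair Λ P P) A) : P →ₗ[Λᵐᵒᵖ] A.car₂ :=
  φ.h₂

theorem sumPair_hom_ext {A : TPair Λ} {φ ψ : TPairHom Λ (sumPair Λ P P) A}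
    (h₁ : sumPairFst φ = sumPairFst ψ) (h₂ : sumPairSnd φ = sumPairSnd ψ) : φ = ψ := by
  refine TPairHom.ext' (LinearMap.prod_ext (M := P) (M₂ := P) h₁ (LinearMap.ext fun y => ?_)) h₂
  exact (φ.comm y).trans ((congrArg A.str (LinearMap.congr_fun h₂ y)).trans (ψ.comm y).symm)

@[simp] theorem sumPairFst_desc {A : TPair Λ} (a : P →ₗ[Λᵐᵒᵖ] A.car₁)
    (b : P →ₗ[Λᵐᵒᵖ] A.car₂) : sumPairFst (sumPairDesc a b) = a :=
  LinearMap.coprod_inl a _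

@[simp] theorem sumPairSnd_desc {A : TPair Λ} (a : P →ₗ[Λᵐᵒᵖ] A.car₁)
    (b : P →ₗ[Λᵐᵒᵖ] A.car₂) : sumPairSnd (sumPairDesc a b) = b :=
  rfl

/-- Functoriality of `P ↦ (P, 0) ⊕ (P, P)_{id}`. -/
def sumPairMap (σ : P →ₗ[Λᵐᵒᵖ] Q) : TPairHom Λ (sumPair Λ P P) (sumPair Λ Q Q) where
  h₁ := (σ.prodMap σ : P × P →ₗ[Λᵐᵒᵖ] Q × Q)
  h₂ := σ
  comm y := by
    change (σ 0, σ y) = (0, σ y)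
    simp

theorem sumPairFst_comp_map {A : TPair Λ} (φ : TPairHom Λ (sumPair Λ Q Q) A)
    (σ : P →ₗ[Λᵐᵒᵖ] Q) : sumPairFst (φ.comp (sumPairMap σ)) = (sumPairFst φ).comp σ := by
  refine LinearMap.ext fun x => ?_
  change φ.h₁ ((σ x, σ 0) : Q × Q) = φ.h₁ ((σ x, 0) : Q × Q)
  rw [map_zero]

theorem sumPairSnd_comp_map {A : TPair Λ} (φ : TPairHom Λ (sumPair Λ Q Q) A)
    (σ : P →ₗ[Λᵐᵒᵖ] Q) : sumPairSnd (φ.comp (sumPairMap σ)) = (sumPairSnd φ).comp σ :=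
  rfl

theorem dTPair_sumPairMap_iff (σ : P →ₗ[Λᵐᵒᵖ] Q) (A : TPair Λ) :
    DTPair (sumPairMap σ) A ↔ DMod σ A.car₁ ∧ DMod σ A.car₂ := by
  constructor
  · refine fun h => ⟨fun g => ?_, fun g => ?_⟩
    · obtain ⟨ψ, hψ⟩ := h (sumPairDesc g 0)
      exact ⟨sumPairFst ψ, by rw [← sumPairFst_comp_map, hψ, sumPairFst_desc]⟩
    · obtain ⟨ψ, hψ⟩ := h (sumPairDesc 0 g)
      exact ⟨sumPairSnd ψ, by rw [← sumPairSnd_comp_map, hψ, sumPairSnd_desc]⟩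
  · rintro ⟨h₁, h₂⟩ φ
    obtain ⟨a, ha⟩ := h₁ (sumPairFst φ)
    obtain ⟨b, hb⟩ := h₂ (sumPairSnd φ)
    exact ⟨sumPairDesc a b, sumPair_hom_ext
      (by rw [sumPairFst_comp_map, sumPairFst_desc, ha])
      (by rw [sumPairSnd_comp_map, sumPairSnd_desc, hb])⟩

theorem tPairProjective_sumPair [Module.Projective Λᵐᵒᵖ P] :
    TPairProjective (sumPair Λ P P) := by
  intro B C g hg₁ hg₂ φ
  obtain ⟨a, ha⟩ := Module.projective_lifting_property g.h₁ (sumPairFst φ) hg₁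
  obtain ⟨b, hb⟩ := Module.projective_lifting_property g.h₂ (sumPairSnd φ) hg₂
  refine ⟨sumPairDesc a b, sumPair_hom_ext (Eq.trans ?_ ha) hb⟩
  exact congrArg g.h₁.comp (sumPairFst_desc a b)

end SumPair

section Generation

theorem genTPair_sumPair_iff (X : Type u) [AddCommGroup X] [Module Λᵐᵒᵖ X] (A : TPair Λ) :
    GenTPair (sumPair Λ X X) A ↔ GenMod Λᵐᵒᵖ X A.car₁ ∧ GenMod Λᵐᵒᵖ X A.car₂ := by
  constructor
  · rintro ⟨ι, φ, h₁, h₂⟩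
    let e := Finsupp.sumFinsuppLEquivProdFinsupp (M := X) (α := ι) (β := ι) Λᵐᵒᵖ
    let c : (ι →₀ X) × (ι →₀ X) →ₗ[Λᵐᵒᵖ] (ι →₀ X × X) :=
      (Finsupp.mapRange.linearMap (LinearMap.inl Λᵐᵒᵖ X X)).coprod
        (Finsupp.mapRange.linearMap (LinearMap.inr Λᵐᵒᵖ X X))
    have hc : Surjective c := fun f =>
      ⟨(Finsupp.mapRange.linearMap (LinearMap.fst Λᵐᵒᵖ X X) f,
        Finsupp.mapRange.linearMap (LinearMap.snd Λᵐᵒᵖ X X) f), by ext i <;> simp [c]⟩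
    exact ⟨⟨ι ⊕ ι, LinearMap.comp (M₂ := ι →₀ X × X) φ.h₁ (c.comp e.toLinearMap),
      h₁.comp (hc.comp e.surjective)⟩, ι, φ.h₂, h₂⟩
  · rintro ⟨⟨J, β, hβ⟩, I, α, hα⟩
    let e := Finsupp.sumFinsuppLEquivProdFinsupp (M := X) (α := I) (β := J) Λᵐᵒᵖ
    let k₂ : (I ⊕ J →₀ X) →ₗ[Λᵐᵒᵖ] A.car₂ :=
      α.comp ((LinearMap.fst Λᵐᵒᵖ _ _).comp e.toLinearMap)
    let k₁ : (I ⊕ J →₀ X) →ₗ[Λᵐᵒᵖ] A.car₁ :=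
      β.comp ((LinearMap.snd Λᵐᵒᵖ _ _).comp e.toLinearMap)
    let q₁ : (I ⊕ J →₀ X × X) →ₗ[Λᵐᵒᵖ] (I ⊕ J →₀ X) :=
      Finsupp.mapRange.linearMap (LinearMap.fst Λᵐᵒᵖ X X)
    let q₂ : (I ⊕ J →₀ X × X) →ₗ[Λᵐᵒᵖ] (I ⊕ J →₀ X) :=
      Finsupp.mapRange.linearMap (LinearMap.snd Λᵐᵒᵖ X X)
    have hk₁ : Surjective k₁ := hβ.comp (Prod.snd_surjective.comp e.surjective)
    have hk₂ : Surjective k₂ := hα.comp (Prod.fst_surjective.comp e.surjective)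
    refine ⟨I ⊕ J, ⟨k₁.comp q₁ + A.str.comp (k₂.comp q₂), k₂, fun y => ?_⟩, ?_, hk₂⟩
    · let j : (I ⊕ J →₀ X) →ₗ[Λᵐᵒᵖ] (I ⊕ J →₀ X × X) :=
        Finsupp.mapRange.linearMap (LinearMap.inr Λᵐᵒᵖ X X)
      have hj₁ (z : I ⊕ J →₀ X) : q₁ (j z) = 0 := by ext; simp [q₁, j]
      have hj₂ (z : I ⊕ J →₀ X) : q₂ (j z) = z := by ext; simp [q₂, j]
      have hj (z : I ⊕ J →₀ X) : k₁ (q₁ (j z)) + A.str (k₂ (q₂ (j z))) = A.str (k₂ z) := by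
        rw [hj₁, hj₂, map_zero, zero_add]
      exact hj y
    · intro a
      obtain ⟨b, rfl⟩ := hk₁ a
      let j : (I ⊕ J →₀ X) →ₗ[Λᵐᵒᵖ] (I ⊕ J →₀ X × X) :=
        Finsupp.mapRange.linearMap (LinearMap.inl Λᵐᵒᵖ X X)
      have e₁ : q₁ (j b) = b := by ext; simp [q₁, j]
      have e₂ : q₂ (j b) = 0 := by ext; simp [q₂, j]
      refine ⟨j b, ?_⟩
      change k₁ (q₁ (j b)) + A.str (k₂ (q₂ (j b))) = k₁ b
      rw [e₁, e₂, map_zero, map_zero, add_zero]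

theorem genMod_of_subsingleton {S : Type u} [Ring S] (X A : Type u) [AddCommGroup X]
    [Module S X] [AddCommGroup A] [Module S A] [Subsingleton A] : GenMod S X A :=
  ⟨PUnit, 0, fun a => ⟨0, Subsingleton.elim _ a⟩⟩

end Generation

section Concentrated

/-- The triple `(0, A)`. -/
def sndPair (Λ : Type u) [Ring Λ] (A : Type u) [AddCommGroup A] [Module Λᵐᵒᵖ A] : TPair Λ :=
  ⟨PUnit.{u + 1}, A, 0⟩

/-- A morphism to `(0, A)` is a linear map from the second component to `A`. -/
def toSndPair {P : TPair Λ} {A : Type u} [AddCommGroup A] [Module Λᵐᵒᵖ A]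
    (g : P.car₂ →ₗ[Λᵐᵒᵖ] A) : TPairHom Λ P (sndPair Λ A) :=
  ⟨(0 : P.car₁ →ₗ[Λᵐᵒᵖ] PUnit.{u + 1}), g, fun _ => rfl⟩

theorem genTPair_sndPair_iff (X : Type u) [AddCommGroup X] [Module Λᵐᵒᵖ X]
    (A : Type u) [AddCommGroup A] [Module Λᵐᵒᵖ A] :
    GenTPair (sumPair Λ X X) (sndPair Λ A) ↔ GenMod Λᵐᵒᵖ X A :=
  (genTPair_sumPair_iff X _).trans
    (and_iff_right (genMod_of_subsingleton (S := Λᵐᵒᵖ) X PUnit))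

theorem dTPair_sndPair_iff {P Q : TPair Λ} (σ : TPairHom Λ P Q)
    (A : Type u) [AddCommGroup A] [Module Λᵐᵒᵖ A] :
    DTPair σ (sndPair Λ A) ↔ DMod σ.h₂ A := by
  constructor
  · intro h g
    obtain ⟨ψ, hψ⟩ := h (toSndPair g)
    exact ⟨ψ.h₂, congrArg TPairHom.h₂ hψ⟩
  · intro h φ
    obtain ⟨g, hg⟩ := h φ.h₂
    exact ⟨toSndPair g, TPairHom.ext' (LinearMap.ext fun _ => rfl) hg⟩

theorem TPairProjective.car₂ {P : TPair Λ} (hP : TPairProjective P) :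
    Module.Projective Λᵐᵒᵖ P.car₂ := by
  refine Module.Projective.of_lifting_property'' fun f hf => ?_
  obtain ⟨ψ, hψ⟩ := hP (sndPair Λ (P.car₂ →₀ Λᵐᵒᵖ)) (sndPair Λ P.car₂) (toSndPair f)
    (fun _ => ⟨0, rfl⟩) hf (toSndPair LinearMap.id)
  exact ⟨ψ.h₂, congrArg TPairHom.h₂ hψ⟩

end Concentrated

section Extensions

theorem ext1VanishMod_of_subsingleton {S : Type u} [Ring S] (X N : Type u) [AddCommGroup X]
    [Module S X] [AddCommGroup N] [Module S N] [Subsingleton N] : Ext1VanishMod S X N := by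
  intro E _ _ i p _ hp hex
  have hinj : Injective p := by
    refine (injective_iff_map_eq_zero p).2 fun e he => ?_
    obtain ⟨n, rfl⟩ := (hex e).1 he
    rw [Subsingleton.elim n 0, map_zero]
  let q := LinearEquiv.ofBijective p ⟨hinj, hp⟩
  exact ⟨q.symm.toLinearMap, LinearMap.ext q.apply_symm_apply⟩

variable {X : Type u} [AddCommGroup X] [Module Λᵐᵒᵖ X] {N : TPair Λ}

theorem Ext1VanishTPair.car₁ (h : Ext1VanishTPair (sumPair Λ X X) N) :
    Ext1VanishMod Λᵐᵒᵖ X N.car₁ := by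
  intro E _ _ i p hi hp hex
  let E' : TPair Λ := ⟨E × X, N.car₂ × X, (i.comp N.str).prodMap LinearMap.id⟩
  let i' : TPairHom Λ N E' :=
    ⟨(LinearMap.inl Λᵐᵒᵖ E X).comp i, LinearMap.inl Λᵐᵒᵖ N.car₂ X, fun _ => rfl⟩
  let p' : TPairHom Λ E' (sumPair Λ X X) :=
    ⟨(p.prodMap LinearMap.id : E × X →ₗ[Λᵐᵒᵖ] X × X), LinearMap.snd Λᵐᵒᵖ N.car₂ X,
      fun y => Prod.ext ((hex _).2 ⟨N.str y.1, rfl⟩) rfl⟩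
  obtain ⟨s, hs⟩ := h E' i' p' (LinearMap.inl_injective.comp hi) LinearMap.inl_injective
    (hp.prodMap surjective_id) Prod.snd_surjective
    (by
      rintro ⟨e, x⟩
      constructor
      · intro he
        obtain ⟨n, hn⟩ := (hex e).1 (congrArg Prod.fst he)
        exact ⟨n, Prod.ext hn (congrArg Prod.snd he).symm⟩
      · rintro ⟨n, hn⟩
        exact Prod.ext ((hex e).2 ⟨n, congrArg Prod.fst hn⟩) (congrArg Prod.snd hn).symm)
    (by
      rintro ⟨n, x⟩
      exact ⟨fun hx => ⟨n, Prod.ext rfl (Eq.symm hx)⟩,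
        fun ⟨m, hm⟩ => (congrArg Prod.snd hm).symm⟩)
  refine ⟨(LinearMap.fst Λᵐᵒᵖ E X).comp (sumPairFst s), LinearMap.ext fun x => ?_⟩
  exact congrArg Prod.fst (LinearMap.congr_fun (congrArg TPairHom.h₁ hs) ((x, 0) : X × X))

theorem Ext1VanishTPair.car₂ (h : Ext1VanishTPair (sumPair Λ X X) N) :
    Ext1VanishMod Λᵐᵒᵖ X N.car₂ := by
  intro E _ _ i p hi hp hex
  -- Extend along the pushout of `i` and the structure map of `N`.
  let W : Submodule Λᵐᵒᵖ (N.car₁ × E) := LinearMap.range (N.str.prod (-i))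
  have hW : W ≤ LinearMap.ker (p.comp (LinearMap.snd Λᵐᵒᵖ N.car₁ E)) := by
    rintro _ ⟨y, rfl⟩
    have : p (i y) = 0 := (hex _).2 ⟨y, rfl⟩
    simp [this]
  let r : ((N.car₁ × E) ⧸ W) →ₗ[Λᵐᵒᵖ] X := W.liftQ _ hW
  let u : N.car₁ →ₗ[Λᵐᵒᵖ] ((N.car₁ × E) ⧸ W) := W.mkQ.comp (LinearMap.inl Λᵐᵒᵖ N.car₁ E)
  let v : E →ₗ[Λᵐᵒᵖ] ((N.car₁ × E) ⧸ W) := W.mkQ.comp (LinearMap.inr Λᵐᵒᵖ N.car₁ E)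
  have huv (y : N.car₂) : u (N.str y) = v (i y) :=
    (Submodule.Quotient.eq W).2 ⟨y, by simp⟩
  have hu : Injective u := by
    refine (injective_iff_map_eq_zero u).2 fun n hn => ?_
    obtain ⟨y, hy⟩ := (Submodule.Quotient.mk_eq_zero W).1 hn
    have hy₂ : -i y = 0 := congrArg Prod.snd hy
    have hy₀ : y = 0 := hi (by rw [neg_eq_zero.1 hy₂, map_zero])
    have hy₁ : N.str y = n := congrArg Prod.fst hy
    rw [← hy₁, hy₀, map_zero]
  have hur : Function.Exact u r := by
    intro z
    constructor
    · obtain ⟨⟨n, e⟩, rfl⟩ := W.mkQ_surjective z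
      intro hz
      obtain ⟨y, rfl⟩ := (hex e).1 hz
      refine ⟨n + N.str y, ?_⟩
      rw [map_add, huv]
      change W.mkQ (n, 0) + W.mkQ (0, i y) = _
      rw [← map_add]
      simp
    · rintro ⟨n, rfl⟩
      exact map_zero p
  have hr : Surjective r := fun x => (hp x).imp' v fun e he => he
  let E' : TPair Λ := ⟨X × ((N.car₁ × E) ⧸ W), E, (LinearMap.inr Λᵐᵒᵖ X _).comp v⟩
  let i' : TPairHom Λ N E' :=
    ⟨(LinearMap.inr Λᵐᵒᵖ X _).comp u, i, fun y => Prod.ext rfl (huv y)⟩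
  let p' : TPairHom Λ E' (sumPair Λ X X) :=
    ⟨(LinearMap.id.prodMap r : _ →ₗ[Λᵐᵒᵖ] X × X), p, fun _ => rfl⟩
  obtain ⟨s, hs⟩ := h E' i' p' (LinearMap.inr_injective.comp hu) hi
    (surjective_id.prodMap hr) hp
    (by
      rintro ⟨x, z⟩
      constructor
      · intro hz
        obtain ⟨n, hn⟩ := (hur z).1 (congrArg Prod.snd hz)
        exact ⟨n, Prod.ext (congrArg Prod.fst hz).symm hn⟩
      · rintro ⟨n, hn⟩
        exact Prod.ext (congrArg Prod.fst hn).symm ((hur z).2 ⟨n, congrArg Prod.snd hn⟩))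
    hex
  exact ⟨s.h₂, congrArg TPairHom.h₂ hs⟩

theorem ext1VanishTPair_sumPair (h₁ : Ext1VanishMod Λᵐᵒᵖ X N.car₁)
    (h₂ : Ext1VanishMod Λᵐᵒᵖ X N.car₂) : Ext1VanishTPair (sumPair Λ X X) N := by
  intro E i p hi₁ hi₂ hp₁ hp₂ hex₁ hex₂
  obtain ⟨b, hb⟩ := h₂ E.car₂ i.h₂ p.h₂ hi₂ hp₂ hex₂
  -- Pull the first component back along the inclusion of the first summand.
  let q : E.car₁ →ₗ[Λᵐᵒᵖ] X × X := p.h₁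
  let K : Submodule Λᵐᵒᵖ E.car₁ := LinearMap.ker ((LinearMap.snd Λᵐᵒᵖ X X).comp q)
  have hqi (n : N.car₁) : q (i.h₁ n) = 0 := (hex₁ _).2 ⟨n, rfl⟩
  obtain ⟨a, ha⟩ := h₁ K (i.h₁.codRestrict K fun n => congrArg Prod.snd (hqi n))
    (((LinearMap.fst Λᵐᵒᵖ X X).comp q).comp K.subtype)
    (fun m n hmn => hi₁ (congrArg Subtype.val hmn))
    (fun x => by
      obtain ⟨e, he⟩ := hp₁ ((x, 0) : X × X)
      exact ⟨⟨e, congrArg Prod.snd he⟩, congrArg Prod.fst he⟩)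
    (by
      rintro ⟨e, he⟩
      constructor
      · intro hz
        obtain ⟨n, hn⟩ := (hex₁ e).1 (Prod.ext hz he)
        exact ⟨n, Subtype.ext hn⟩
      · rintro ⟨n, hn⟩
        rw [← hn]
        exact congrArg Prod.fst (hqi n))
  refine ⟨sumPairDesc (K.subtype.comp a) b, sumPair_hom_ext (LinearMap.ext fun x => ?_) hb⟩
  change p.h₁ (sumPairFst (sumPairDesc (K.subtype.comp a) b) x) = ((x, 0) : X × X)
  rw [sumPairFst_desc]
  exact Prod.ext (LinearMap.congr_fun ha x) (a x).2

theorem ext1VanishTPair_sumPair_iff : Ext1VanishTPair (sumPair Λ X X) N ↔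
    Ext1VanishMod Λᵐᵒᵖ X N.car₁ ∧ Ext1VanishMod Λᵐᵒᵖ X N.car₂ :=
  ⟨fun h => ⟨h.car₁, h.car₂⟩, fun h => ext1VanishTPair_sumPair h.1 h.2⟩

end Extensions

variable (X : Type u) [AddCommGroup X] [Module Λᵐᵒᵖ X]

theorem isSiltingTPair_sumPair_iff :
    IsSiltingTPair (sumPair Λ X X) ↔ IsSiltingMod Λᵐᵒᵖ X := by
  constructor
  · rintro ⟨P, Q, σ, π, hP, hQ, _, hπ₂, _, hex₂, hD⟩
    refine ⟨ModuleCat.of Λᵐᵒᵖ P.car₂, ModuleCat.of Λᵐᵒᵖ Q.car₂, σ.h₂, π.h₂, hP.car₂, hQ.car₂,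
      hπ₂, hex₂, fun A _ _ => ?_⟩
    exact (genTPair_sndPair_iff X A).symm.trans ((hD _).trans (dTPair_sndPair_iff σ A))
  · rintro ⟨P, Q, σ, π, hP, hQ, hπ, hex, hD⟩
    refine ⟨sumPair Λ P P, sumPair Λ Q Q, sumPairMap σ, sumPairMap π, tPairProjective_sumPair,
      tPairProjective_sumPair, hπ.prodMap hπ, hπ, ?_, hex, fun A => ?_⟩
    · rintro ⟨x, y⟩
      constructor
      · intro h
        obtain ⟨a, ha⟩ := (hex x).1 (congrArg Prod.fst h)
        obtain ⟨b, hb⟩ := (hex y).1 (congrArg Prod.snd h)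
        exact ⟨((a, b) : P × P), Prod.ext ha hb⟩
      · rintro ⟨⟨a, b⟩, h⟩
        exact Prod.ext ((hex x).2 ⟨a, congrArg Prod.fst h⟩)
          ((hex y).2 ⟨b, congrArg Prod.snd h⟩)
    · rw [genTPair_sumPair_iff, dTPair_sumPairMap_iff, hD, hD]

theorem isTiltingTPair_sumPair_iff :
    IsTiltingTPair (sumPair Λ X X) ↔ IsTiltingMod Λᵐᵒᵖ X := by
  constructor
  · intro h A _ _
    refine (genTPair_sndPair_iff X A).symm.trans
      ((h _).trans (ext1VanishTPair_sumPair_iff.trans ?_))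
    exact and_iff_right (ext1VanishMod_of_subsingleton (S := Λᵐᵒᵖ) X PUnit)
  · intro h N
    rw [genTPair_sumPair_iff, ext1VanishTPair_sumPair_iff, h, h]

end TriangularLemmas

/-- Corollary 3.9, final claim.  For `R = (Λ 0; Λ Λ)`, the right
`R`-module `(X, 0) ⊕ (X, X)_{id}` is silting (resp. tilting) iff `X` is a silting
(resp. tilting) right `Λ`-module. -/
theorem stmt12
    {Λ : Type u} [Ring Λ]
    (X : Type u) [AddCommGroup X] [Module Λᵐᵒᵖ X] :
    (IsSiltingTPair (sumPair Λ X X) ↔ IsSiltingMod Λᵐᵒᵖ X) ∧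
      (IsTiltingTPair (sumPair Λ X X) ↔ IsTiltingMod Λᵐᵒᵖ X) := by
  exact ⟨isSiltingTPair_sumPair_iff X, isTiltingTPair_sumPair_iff X⟩
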